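/- arXiv:1408.5531 — 4 statements merged into one kernel-verified Lean document; each statement's English description precedes it below -/
import Mathlib

section
/- Let n, k, m be positive integers with n > k + m and set ℓ = n − k − m. Let Z : ℂⁿ → ℂ^{k+m} be a surjective ℂ-linear map. Let G• = (0 = G_0 ⊂ G_1 ⊂ ⋯ ⊂ G_{k+m} = ℂ^{k+m}) be a full flag in ℂ^{k+m} (dim G_j = j), and let F• = (0 = F_0 ⊂ F_1 ⊂ ⋯ ⊂ F_n = ℂⁿ) be a full flag in ℂⁿ (dim F_j = j) such that F_{ℓ+j} = Z⁻¹(G_j) for all 0 ≤ j ≤ k+m. Let I ⊆ {1,…,k+m} be a k-element subset, regarded as a subset of {1,…,n} via the inclusion {1,…,k+m} ⊆ {1,…,n}. Then for every k-dimensional subspace X ⊆ ℂⁿ with X ∩ ker(Z) = 0, the following are equivalent: (i) dim(Z(X) ∩ G_j) ≥ #(I ∩ [k+m−j+1, k+m]) for all j ∈ {1,…,k+m}; (ii) dim(X ∩ F_j) ≥ #(I ∩ [n−j+1, n]) for all j ∈ {1,…,n}. -/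
/-- A linear map that is injective on `p` preserves the dimension of the intersection of `p`
with the preimage of a subspace. -/
theorem finrank_map_inf_eq_finrank_inf_comap {K V W : Type*} [DivisionRing K]
    [AddCommGroup V] [Module K V] [AddCommGroup W] [Module K W] (f : V →ₗ[K] W)
    (p : Submodule K V) (q : Submodule K W) (hp : p ⊓ LinearMap.ker f = ⊥) :
    Module.finrank K ↥(p.map f ⊓ q) = Module.finrank K ↥(p ⊓ q.comap f) := by
  have hmap : p.map f ⊓ q = LinearMap.range (f.domRestrict (p ⊓ q.comap f)) := by
    rw [LinearMap.range_domRestrict]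
    ext y
    constructor
    · rintro ⟨⟨x, hx, rfl⟩, hy⟩
      exact ⟨x, ⟨hx, hy⟩, rfl⟩
    · rintro ⟨x, ⟨hx, hy⟩, rfl⟩
      exact ⟨⟨x, hx, rfl⟩, hy⟩
  rw [hmap]
  apply LinearMap.finrank_range_of_inj
  rw [← LinearMap.ker_eq_bot, LinearMap.ker_eq_bot']
  rintro ⟨x, hx⟩ h
  have hmem : x ∈ p ⊓ LinearMap.ker f := ⟨hx.1, h⟩
  rw [hp, Submodule.mem_bot] at hmem
  exact Subtype.ext hmem

/-- Let `Z : ℂⁿ → ℂ^{k+m}` be a surjective linear map (`n > k+m`,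
`ℓ = n−k−m`), let `G•` be a full flag in `ℂ^{k+m}`, and let `F•` be a full flag in `ℂⁿ`
with `F_{ℓ+j} = Z⁻¹(G_j)` for `0 ≤ j ≤ k+m`.  For a `k`-element subset
`I ⊆ {1,…,k+m} ⊆ {1,…,n}` and any `k`-dimensional subspace `X ⊆ ℂⁿ` with
`X ∩ ker Z = 0`, the Schubert conditions for `Z(X)` w.r.t. `G•` and for `X` w.r.t. `F•`
are equivalent. -/
theorem stmt2 (n k m : ℕ) (hk : 0 < k) (hm : 0 < m) (hn : k + m < n)
    (Z : (Fin n → ℂ) →ₗ[ℂ] (Fin (k + m) → ℂ)) (hZ : Function.Surjective Z)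
    (G : ℕ → Submodule ℂ (Fin (k + m) → ℂ))
    (hGrank : ∀ j ≤ k + m, Module.finrank ℂ (G j) = j)
    (hGmono : ∀ j < k + m, G j ≤ G (j + 1))
    (F : ℕ → Submodule ℂ (Fin n → ℂ))
    (hFrank : ∀ j ≤ n, Module.finrank ℂ (F j) = j)
    (hFmono : ∀ j < n, F j ≤ F (j + 1))
    (hcompat : ∀ j ≤ k + m, F ((n - k - m) + j) = (G j).comap Z)
    (I : Finset ℕ) (hI : I ⊆ Finset.Icc 1 (k + m)) (hIcard : I.card = k)
    (X : Submodule ℂ (Fin n → ℂ)) (hX : Module.finrank ℂ X = k)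
    (hXE : X ⊓ LinearMap.ker Z = ⊥) :
    (∀ j ∈ Finset.Icc 1 (k + m),
        (I ∩ Finset.Icc (k + m - j + 1) (k + m)).card ≤
          Module.finrank ℂ ↥(X.map Z ⊓ G j)) ↔
    (∀ j ∈ Finset.Icc 1 n,
        (I ∩ Finset.Icc (n - j + 1) n).card ≤ Module.finrank ℂ ↥(X ⊓ F j)) := by
  have hrank : ∀ j ≤ k + m, Module.finrank ℂ ↥(X.map Z ⊓ G j) =
      Module.finrank ℂ ↥(X ⊓ F ((n - k - m) + j)) := fun j hj => by
    rw [hcompat j hj, finrank_map_inf_eq_finrank_inf_comap Z X (G j) hXE]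
  have hinter : ∀ a, I ∩ Finset.Icc a n = I ∩ Finset.Icc a (k + m) := fun a => by
    ext i
    simp only [Finset.mem_inter, Finset.mem_Icc]
    refine and_congr_right fun hi => ?_
    have := Finset.mem_Icc.mp (hI hi)
    omega
  simp only [hinter, Finset.mem_Icc]
  constructor
  · rintro h j ⟨hj1, hjn⟩
    by_cases hj : j ≤ n - k - m
    · rw [Finset.Icc_eq_empty (by omega)]
      simp
    · obtain ⟨i, rfl⟩ := Nat.exists_eq_add_of_le (le_of_not_ge hj)
      have hi := h i (by omega)
      rwa [hrank i (by omega),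
        show k + m - i + 1 = n - (n - k - m + i) + 1 by omega] at hi
  · rintro h j ⟨hj1, hjn⟩
    have hj := h (n - k - m + j) (by omega)
    rwa [← hrank j hjn, show n - (n - k - m + j) + 1 = k + m - j + 1 by omega] at hj
end

section
/- Let n, k, m be positive integers with n > k + m, and let Z : ℂⁿ → ℂ^{k+m} be a surjective ℂ-linear map. Let F• = (0 = F_0 ⊂ F_1 ⊂ ⋯ ⊂ F_n = ℂⁿ) be any full flag in ℂⁿ (dim F_j = j) with F_{n−k−m} = ker(Z), and let I = {1, 2, …, k−1} ∪ {k+m+1} ⊆ {1,…,n}. Then for every k-dimensional subspace X ⊆ ℂⁿ, one has X ∩ ker(Z) ≠ 0 if and only if dim(X ∩ F_j) ≥ #(I ∩ [n−j+1, n]) for all j ∈ {1,…,n}. -/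
/-- At most `k - a + 1` elements of `{1,…,k-1} ∪ {c}` lie in `{a,…,n}`. -/
theorem card_Icc_union_singleton_inter_le (k c a n : ℕ) :
    ((Finset.Icc 1 (k - 1) ∪ {c}) ∩ Finset.Icc a n).card ≤ k - a + 1 := by
  have hsub : (Finset.Icc 1 (k - 1) ∪ {c}) ∩ Finset.Icc a n ⊆
      insert c (Finset.Ico a k) := by
    intro x hx
    simp only [Finset.mem_inter, Finset.mem_union, Finset.mem_Icc, Finset.mem_singleton] at hx
    simp only [Finset.mem_insert, Finset.mem_Ico]
    omega
  calc _ ≤ (insert c (Finset.Ico a k)).card := Finset.card_le_card hsub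
    _ ≤ (Finset.Ico a k).card + 1 := Finset.card_insert_le _ _
    _ = k - a + 1 := by rw [Nat.card_Ico]

/-- Two subspaces meet in at least the expected dimension. -/
theorem Submodule.finrank_add_finrank_le_finrank_add_finrank_inf {K V : Type*} [DivisionRing K]
    [AddCommGroup V] [Module K V] [FiniteDimensional K V] (X Y : Submodule K V) :
    Module.finrank K X + Module.finrank K Y ≤
      Module.finrank K V + Module.finrank K ↥(X ⊓ Y) := by
  rw [← Submodule.finrank_sup_add_finrank_inf_eq X Y]
  exact Nat.add_le_add_right (Submodule.finrank_le _) _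

/-- Let `Z : ℂⁿ → ℂ^{k+m}` be a surjective linear map (`n > k+m`) and let
`F•` be any full flag in `ℂⁿ` with `F_{n−k−m} = ker Z`.  With
`I = {1,…,k−1} ∪ {k+m+1}`, a `k`-dimensional subspace `X ⊆ ℂⁿ` satisfies
`X ∩ ker Z ≠ 0` if and only if `X` satisfies the Schubert conditions
`dim(X ∩ F_j) ≥ #(I ∩ [n−j+1, n])` for all `j ∈ {1,…,n}`,
i.e. the exceptional locus `E_Z` is the Schubert variety `X_I(F•)`. -/
theorem stmt4 (n k m : ℕ) (hk : 0 < k) (hm : 0 < m) (hn : k + m < n)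
    (Z : (Fin n → ℂ) →ₗ[ℂ] (Fin (k + m) → ℂ)) (hZ : Function.Surjective Z)
    (F : ℕ → Submodule ℂ (Fin n → ℂ))
    (hFrank : ∀ j ≤ n, Module.finrank ℂ (F j) = j)
    (hFmono : ∀ j < n, F j ≤ F (j + 1))
    (hker : F (n - k - m) = LinearMap.ker Z)
    (X : Submodule ℂ (Fin n → ℂ)) (hX : Module.finrank ℂ X = k) :
    X ⊓ LinearMap.ker Z ≠ ⊥ ↔
      ∀ j ∈ Finset.Icc 1 n,
        ((Finset.Icc 1 (k - 1) ∪ {k + m + 1}) ∩ Finset.Icc (n - j + 1) n).card ≤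
          Module.finrank ℂ ↥(X ⊓ F j) := by
  have hmono : ∀ i j, i ≤ j → j ≤ n → F i ≤ F j := by
    intro i j hij
    induction j, hij using Nat.le_induction with
    | base => exact fun _ => le_rfl
    | succ j _ ih => exact fun hj => (ih (by omega)).trans (hFmono j (by omega))
  constructor
  · intro hne j hj
    obtain ⟨hj1, hjn⟩ := Finset.mem_Icc.mp hj
    by_cases hsmall : j < n - k - m
    · have hempty : (Finset.Icc 1 (k - 1) ∪ {k + m + 1}) ∩ Finset.Icc (n - j + 1) n = ∅ := by
        ext x
        simp only [Finset.mem_inter, Finset.mem_union, Finset.mem_Icc, Finset.mem_singleton,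
          Finset.notMem_empty, iff_false]
        omega
      rw [hempty, Finset.card_empty]
      exact Nat.zero_le _
    · have hcard := card_Icc_union_singleton_inter_le k (k + m + 1) (n - j + 1) n
      have hdim := Submodule.finrank_add_finrank_le_finrank_add_finrank_inf X (F j)
      rw [hX, hFrank j hjn, Module.finrank_fin_fun] at hdim
      have hpos : 1 ≤ Module.finrank ℂ ↥(X ⊓ F j) :=
        (Submodule.one_le_finrank_iff.mpr hne).trans <|
          Submodule.finrank_mono <| inf_le_inf_left X <|
            hker ▸ hmono _ _ (not_lt.mp hsmall) hjn
      omega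
  · intro h
    have hmem : k + m + 1 ∈ (Finset.Icc 1 (k - 1) ∪ {k + m + 1}) ∩
        Finset.Icc (n - (n - k - m) + 1) n := by
      simp only [Finset.mem_inter, Finset.mem_union, Finset.mem_Icc, Finset.mem_singleton,
        or_true, true_and]
      omega
    have hdim := h (n - k - m) (Finset.mem_Icc.mpr (by omega))
    rw [hker] at hdim
    exact Submodule.one_le_finrank_iff.mp ((Finset.card_pos.mpr ⟨_, hmem⟩).trans_le hdim)
end

section
/- Let k, n be positive integers and let v : ℤ → ℂᵏ satisfy v(i+n) = v(i) for all i ∈ ℤ, with span_ℂ{v(1), …, v(n)} = ℂᵏ. Define f : ℤ → ℤ by f(i) = min { j ∈ ℤ : j ≥ i and v(i) ∈ span_ℂ{ v(t) : i < t ≤ j } } (this minimum exists). Then f is a bijection from ℤ to ℤ. -/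
open Submodule in
/-- If `j` is the least index `≥ i` with `v i ∈ span {v t : i < t ≤ j}`, then `v j` lies in the span
of the vectors `v t` with `i ≤ t < j`. -/
lemma mem_span_image_Ico_of_isLeast {K V : Type*} [DivisionRing K] [AddCommGroup V] [Module K V]
    {v : ℤ → V} {i j : ℤ}
    (h : IsLeast {j : ℤ | i ≤ j ∧ v i ∈ span K (v '' Set.Ioc i j)} j) :
    v j ∈ span K (v '' Set.Ico i j) := by
  obtain ⟨⟨hij, hmem⟩, hmin⟩ := h
  obtain rfl | hlt := hij.eq_or_lt
  · simpa using hmem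
  have hnot : v i ∉ span K (v '' Set.Ioo i j) := fun hi ↦ by
    have hIoo : Set.Ioo i j = Set.Ioc i (j - 1) := by ext; simp
    have := hmin ⟨by lia, hIoo ▸ hi⟩
    lia
  rw [← Set.Ioo_insert_right hlt, Set.image_insert_eq] at hmem
  rw [← Set.Ioo_insert_left hlt, Set.image_insert_eq]
  exact mem_span_insert_exchange hmem hnot

open Submodule in
/-- If `i` is the greatest index `≤ j` with `v j ∈ span {v t : i ≤ t < j}`, then `j` is the least
index `≥ i` with `v i ∈ span {v t : i < t ≤ j}`. -/
lemma isLeast_of_isGreatest_mem_span_image_Ico {K V : Type*} [DivisionRing K] [AddCommGroup V]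
    [Module K V] {v : ℤ → V} {i j : ℤ}
    (h : IsGreatest {i : ℤ | i ≤ j ∧ v j ∈ span K (v '' Set.Ico i j)} i) :
    IsLeast {j : ℤ | i ≤ j ∧ v i ∈ span K (v '' Set.Ioc i j)} j := by
  obtain ⟨⟨hij, hmem⟩, hmax⟩ := h
  obtain rfl | hlt := hij.eq_or_lt
  · exact ⟨⟨le_rfl, by simpa using hmem⟩, fun _ hm ↦ hm.1⟩
  have hnot : v j ∉ span K (v '' Set.Ioo i j) := fun hj ↦ by
    have hIoo : Set.Ioo i j = Set.Ico (i + 1) j := by ext; simp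
    have := hmax ⟨by lia, hIoo ▸ hj⟩
    lia
  rw [← Set.Ioo_insert_left hlt, Set.image_insert_eq] at hmem
  refine ⟨⟨hij, ?_⟩, fun m hm ↦ ?_⟩
  · rw [← Set.Ioo_insert_right hlt, Set.image_insert_eq]
    exact mem_span_insert_exchange hmem hnot
  · by_contra! hmj
    have hsub : Set.Ioc i m ⊆ Set.Ioo i j := fun t ht ↦ ⟨ht.1, ht.2.trans_lt hmj⟩
    rw [span_insert_eq_span (span_mono (Set.image_mono hsub) hm.2)] at hmem
    exact hnot hmem


/-- Let `v : ℤ → ℂᵏ` be `n`-periodic with `span{v(1),…,v(n)} = ℂᵏ`, and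
let `f : ℤ → ℤ` be defined by `f(i) = min {j ≥ i : v(i) ∈ span{v(t) : i < t ≤ j}}`
(this minimum exists).  Then `f` is a bijection of `ℤ`. -/
theorem stmt6 (k n : ℕ) (hk : 0 < k) (hn : 0 < n) (v : ℤ → Fin k → ℂ)
    (hper : ∀ i : ℤ, v (i + n) = v i)
    (hspan : Submodule.span ℂ (v '' Set.Icc (1 : ℤ) (n : ℤ)) = ⊤)
    (f : ℤ → ℤ)
    (hf : ∀ i : ℤ,
      IsLeast {j : ℤ | i ≤ j ∧ v i ∈ Submodule.span ℂ (v '' Set.Ioc i j)} (f i)) :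
    Function.Bijective f := by
  refine ⟨fun a b hab ↦ ?_, fun j ↦ ?_⟩
  · wlog hlt : a < b generalizing a b
    · by_contra hne
      exact hne (this b a hab.symm (by lia)).symm
    have hb := mem_span_image_Ico_of_isLeast (hf b)
    have hbj : b ≤ f b := (hf b).1.1
    rw [← hab] at hb hbj
    obtain ⟨⟨haj, hmem⟩, hmin⟩ := hf a
    have hsub : Set.Ico b (f a) ⊆ Set.Ioo a (f a) := fun t ht ↦ ⟨hlt.trans_le ht.1, ht.2⟩
    rw [← Set.Ioo_insert_right (hlt.trans_le hbj), Set.image_insert_eq,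
      Submodule.span_insert_eq_span (Submodule.span_mono (Set.image_mono hsub) hb)] at hmem
    have hIoo : Set.Ioo a (f a) = Set.Ioc a (f a - 1) := by ext; simp
    have := hmin ⟨by lia, hIoo ▸ hmem⟩
    lia
  · have hex : ∃ i, i ≤ j ∧ v j ∈ Submodule.span ℂ (v '' Set.Ico i j) := by
      refine ⟨j - n, by lia, Submodule.subset_span ⟨j - n, ⟨le_rfl, by lia⟩, ?_⟩⟩
      rw [← hper, sub_add_cancel]
    obtain ⟨i, hi, hmax⟩ := Int.exists_greatest_of_bdd ⟨j, fun _ h ↦ h.1⟩ hex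
    exact ⟨i, (hf i).unique (isLeast_of_isGreatest_mem_span_image_Ico ⟨hi, hmax⟩)⟩
end

section
/- Let k, n be positive integers and let v : ℤ → ℂᵏ satisfy v(i+n) = v(i) for all i ∈ ℤ, with span_ℂ{v(1), …, v(n)} = ℂᵏ. Define f : ℤ → ℤ by f(i) = min { j ∈ ℤ : j ≥ i and v(i) ∈ span_ℂ{ v(t) : i < t ≤ j } } (this minimum exists). Then Σ_{i=1}^{n} (f(i) − i) = k·n. -/
open Module

section IntervalRank

variable {K V : Type*} [DivisionRing K] [AddCommGroup V] [Module K V]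

/-- The rank of the family `v` on the window `(i, i + m]`, as an integer. -/
noncomputable def intervalRank (K : Type*) {V : Type*} [DivisionRing K] [AddCommGroup V]
    [Module K V] (v : ℤ → V) (i : ℤ) (m : ℕ) : ℤ :=
  finrank K (Submodule.span K (v '' Set.Ioc i (i + m)))

theorem intervalRank_zero (v : ℤ → V) (i : ℤ) : intervalRank K v i 0 = 0 := by
  rw [intervalRank, Nat.cast_zero, add_zero, Set.Ioc_self, Set.image_empty, Submodule.span_empty,
    finrank_bot, Nat.cast_zero]

theorem intervalRank_add_period {v : ℤ → V} {c : ℤ} (hv : Function.Periodic v c) (i : ℤ) (m : ℕ) :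
    intervalRank K v (i + c) m = intervalRank K v i m := by
  have h : Set.Ioc (i + c) (i + c + m) = (fun x => x + c) '' Set.Ioc i (i + m) := by
    rw [Set.image_add_const_Ioc, add_right_comm]
  have hcomp : (fun x => v (x + c)) = v := funext hv
  rw [intervalRank, h, Set.image_image, hcomp, intervalRank]

theorem intervalRank_period {v : ℤ → V} {n : ℕ} (hn : 0 < n) (hv : Function.Periodic v (n : ℤ))
    (hspan : Submodule.span K (Set.range v) = ⊤) (i : ℤ) :
    intervalRank K v i n = finrank K V := by
  rw [intervalRank, hv.image_Ioc (by exact_mod_cast hn), hspan, finrank_top]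

theorem intervalRank_succ [FiniteDimensional K V] (v : ℤ → V) (i : ℤ) (m : ℕ)
    [Decidable (v (i + 1) ∈ Submodule.span K (v '' Set.Ioc (i + 1) (i + 1 + m)))] :
    intervalRank K v i (m + 1) = intervalRank K v (i + 1) m +
      if v (i + 1) ∈ Submodule.span K (v '' Set.Ioc (i + 1) (i + 1 + m)) then 0 else 1 := by
  have h : Set.Ioc i (i + (m + 1 : ℕ)) = insert (i + 1) (Set.Ioc (i + 1) (i + 1 + m)) := by
    ext x
    simp only [Set.mem_Ioc, Set.mem_insert_iff]
    omega
  rw [intervalRank, h, Set.image_insert_eq, intervalRank]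
  split_ifs with hmem
  · rw [Submodule.span_insert_eq_span hmem, add_zero]
  · rw [Submodule.span_insert, sup_comm, Submodule.finrank_sup_span_singleton hmem]
    push_cast
    rfl

/-- Telescoping over both the position and the length of a window. -/
theorem sum_intervalRank_sub {v : ℤ → V} {n : ℕ} (hn : 0 < n) (hv : Function.Periodic v (n : ℤ))
    (hspan : Submodule.span K (Set.range v) = ⊤) :
    ∑ x ∈ Finset.range n, ∑ m ∈ Finset.range n,
      (intervalRank K v x (m + 1) - intervalRank K v (x + 1) m) = finrank K V * n := by
  have hshift (m : ℕ) : ∑ x ∈ Finset.range n, intervalRank K v (x + 1) m =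
      ∑ x ∈ Finset.range n, intervalRank K v x m := by
    have h := Finset.sum_range_sub (fun x : ℕ => intervalRank K v x m) n
    have hper := intervalRank_add_period (K := K) hv 0 m
    rw [zero_add] at hper
    simp only [Finset.sum_sub_distrib, Nat.cast_add, Nat.cast_one, Nat.cast_zero, hper,
      sub_self] at h
    exact sub_eq_zero.mp h
  have hlen (x : ℕ) : ∑ m ∈ Finset.range n, (intervalRank K v x (m + 1) - intervalRank K v x m) =
      finrank K V := by
    rw [Finset.sum_range_sub, intervalRank_period hn hv hspan, intervalRank_zero, sub_zero]
  calc _ = ∑ x ∈ Finset.range n, ∑ m ∈ Finset.range n,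
        (intervalRank K v x (m + 1) - intervalRank K v x m) := by
        rw [Finset.sum_comm]
        conv_rhs => rw [Finset.sum_comm]
        simp only [Finset.sum_sub_distrib, hshift]
    _ = finrank K V * n := by simp [hlen, mul_comm]

end IntervalRank

theorem sum_range_ite_le_add {i j : ℤ} {n : ℕ} (hij : i ≤ j) (hjn : j ≤ i + n) :
    ∑ m ∈ Finset.range n, (if j ≤ i + (m : ℤ) then (0 : ℤ) else 1) = j - i := by
  obtain ⟨d, rfl⟩ := Int.le.dest hij
  have hd : d ≤ n := by omega
  have h : (Finset.range n).filter (fun m : ℕ => ¬ (i + d ≤ i + (m : ℤ))) = Finset.range d := by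
    ext m
    simp only [Finset.mem_filter, Finset.mem_range]
    omega
  rw [Finset.sum_ite, Finset.sum_const_zero, h]
  simp

/-- Let `v : ℤ → ℂᵏ` be `n`-periodic with `span{v(1),…,v(n)} = ℂᵏ`, and
let `f : ℤ → ℤ` be defined by `f(i) = min {j ≥ i : v(i) ∈ span{v(t) : i < t ≤ j}}`
(this minimum exists).  Then `Σ_{i=1}^{n} (f(i) − i) = k·n`. -/
theorem stmt7 (k n : ℕ) (hk : 0 < k) (hn : 0 < n) (v : ℤ → Fin k → ℂ)
    (hper : ∀ i : ℤ, v (i + n) = v i)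
    (hspan : Submodule.span ℂ (v '' Set.Icc (1 : ℤ) (n : ℤ)) = ⊤)
    (f : ℤ → ℤ)
    (hf : ∀ i : ℤ,
      IsLeast {j : ℤ | i ≤ j ∧ v i ∈ Submodule.span ℂ (v '' Set.Ioc i j)} (f i)) :
    ∑ i ∈ Finset.Icc (1 : ℤ) (n : ℤ), (f i - i) = (k : ℤ) * n := by
  classical
  have hrange : Submodule.span ℂ (Set.range v) = ⊤ :=
    top_unique (hspan ▸ Submodule.span_mono (Set.image_subset_range _ _))
  have hmem (i : ℤ) (m : ℕ) :
      v i ∈ Submodule.span ℂ (v '' Set.Ioc i (i + m)) ↔ f i ≤ i + m := by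
    refine ⟨fun h => (hf i).2 ⟨by omega, h⟩, fun h => ?_⟩
    exact Submodule.span_mono (Set.image_mono (Set.Ioc_subset_Ioc_right h)) (hf i).1.2
  have hle (i : ℤ) : f i ≤ i + n := by
    rw [← hmem, ← hper i]
    exact Submodule.subset_span ⟨i + n, ⟨by omega, le_rfl⟩, rfl⟩
  have hcount (i : ℤ) : f (i + 1) - (i + 1) = ∑ m ∈ Finset.range n,
      (intervalRank ℂ v i (m + 1) - intervalRank ℂ v (i + 1) m) := by
    rw [← sum_range_ite_le_add (hf (i + 1)).1.1 (hle (i + 1))]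
    simp only [intervalRank_succ, hmem, add_sub_cancel_left]
  have hreindex : ∑ i ∈ Finset.Icc (1 : ℤ) (n : ℤ), (f i - i) =
      ∑ x ∈ Finset.range n, (f (x + 1) - (x + 1)) := by
    refine (Finset.sum_bij (fun (x : ℕ) _ => (x : ℤ) + 1) ?_ ?_ ?_ fun _ _ => rfl).symm
    · intro x hx
      simp only [Finset.mem_range, Finset.mem_Icc] at hx ⊢
      omega
    · intro x _ y _ h
      omega
    · intro i hi
      simp only [Finset.mem_Icc] at hi
      exact ⟨(i - 1).toNat, by simp only [Finset.mem_range]; omega, by omega⟩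
  rw [hreindex]
  simp only [hcount]
  rw [sum_intervalRank_sub hn hper hrange, Module.finrank_fin_fun]
end
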